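/- arXiv:2102.02924 — 8 statements merged into one kernel-verified Lean document; each statement's English description precedes it below -/
import Mathlib

section
/- Let S be a finite simple graph on n vertices with Laplacian matrix L = D − A (D the diagonal degree matrix, A the adjacency matrix). Let d_1 ≤ d_2 ≤ … ≤ d_n be the vertex degrees of S sorted in ascending order, and let μ_1 ≤ μ_2 ≤ … ≤ μ_n be the eigenvalues of L sorted in ascending order. Then for every index i with 1 ≤ i ≤ n, one has μ_i ≤ 2·d_i. -/
open Matrix

/-- The quadratic form of the Laplacian is at most twice the degree-weighted sum of squares. -/
theorem SimpleGraph.dotProduct_lapMatrix_mulVec_le {V : Type*} [Fintype V] [DecidableEq V]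
    (G : SimpleGraph V) [DecidableRel G.Adj] (x : V → ℝ) :
    x ⬝ᵥ G.lapMatrix ℝ *ᵥ x ≤ ∑ k, 2 * (G.degree k : ℝ) * x k ^ 2 := by
  have key : ∀ a b, (if G.Adj a b then (x a - x b) ^ 2 else 0) ≤
      (if G.Adj a b then 2 * x a ^ 2 else 0) + (if G.Adj a b then 2 * x b ^ 2 else 0) := by
    intro a b
    split_ifs
    · nlinarith [sq_nonneg (x a + x b)]
    · simp
  have row : ∑ a, ∑ b, (if G.Adj a b then 2 * x a ^ 2 else 0) =
      ∑ k, 2 * (G.degree k : ℝ) * x k ^ 2 := by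
    refine Finset.sum_congr rfl fun a _ => ?_
    rw [← Finset.sum_filter, Finset.sum_const, ← G.neighborFinset_eq_filter,
      G.card_neighborFinset_eq_degree, nsmul_eq_mul]
    ring
  have col : ∑ a, ∑ b, (if G.Adj a b then 2 * x b ^ 2 else 0) =
      ∑ k, 2 * (G.degree k : ℝ) * x k ^ 2 := by
    rw [Finset.sum_comm, ← row]
    simp only [G.adj_comm]
  have total := Finset.sum_le_sum fun a (_ : a ∈ Finset.univ) =>
    Finset.sum_le_sum fun b (_ : b ∈ Finset.univ) => key a b
  simp only [Finset.sum_add_distrib] at total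
  rw [row, col] at total
  rw [← toLinearMap₂'_apply', G.lapMatrix_toLinearMap₂' ℝ]
  linarith

/-- A vector orthogonal to all eigenvectors with eigenvalue below `c` has Rayleigh quotient
at least `c`. -/
theorem Matrix.IsHermitian.mul_dotProduct_self_le {ι : Type*} [Fintype ι] [DecidableEq ι]
    {A : Matrix ι ι ℝ} (hA : A.IsHermitian) {c : ℝ} {x : ι → ℝ}
    (h : ∀ j, hA.eigenvalues j < c → (hA.eigenvectorBasis j).ofLp ⬝ᵥ x = 0) :
    c * (x ⬝ᵥ x) ≤ x ⬝ᵥ A *ᵥ x := by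
  have parseval : ∀ y : ι → ℝ, x ⬝ᵥ y = ∑ j,
      ((hA.eigenvectorBasis j).ofLp ⬝ᵥ x) * ((hA.eigenvectorBasis j).ofLp ⬝ᵥ y) := by
    intro y
    have := hA.eigenvectorBasis.sum_inner_mul_inner (WithLp.toLp 2 x) (WithLp.toLp 2 y)
    simp only [EuclideanSpace.inner_eq_star_dotProduct, star_trivial] at this
    rw [dotProduct_comm, ← this]
    exact Finset.sum_congr rfl fun j _ => by rw [dotProduct_comm y]
  have eig : ∀ j, (hA.eigenvectorBasis j).ofLp ⬝ᵥ A *ᵥ x =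
      hA.eigenvalues j * ((hA.eigenvectorBasis j).ofLp ⬝ᵥ x) := by
    intro j
    have hT : Aᵀ = A := by simpa using hA.eq
    rw [dotProduct_mulVec, ← mulVec_transpose, hT, hA.mulVec_eigenvectorBasis, smul_dotProduct,
      smul_eq_mul]
  rw [parseval, parseval, Finset.mul_sum]
  refine Finset.sum_le_sum fun j _ => ?_
  rw [eig]
  rcases lt_or_ge (hA.eigenvalues j) c with hj | hj
  · simp [h j hj]
  · nlinarith [mul_le_mul_of_nonneg_right hj
      (mul_self_nonneg ((hA.eigenvectorBasis j).ofLp ⬝ᵥ x))]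

/-- For a finite simple graph `G` on `n` vertices with Laplacian matrix `L = D - A`,
if `d` is the degree sequence sorted in ascending order and `μ` is the sequence of
Laplacian eigenvalues sorted in ascending order, then `μ i ≤ 2 * d i` for every `i`. -/
theorem laplacian_eigenvalue_le_two_mul_degree
    {n : ℕ} (G : SimpleGraph (Fin n)) [DecidableRel G.Adj]
    (hL : (G.lapMatrix ℝ).IsHermitian)
    (d μ : Fin n → ℝ) (hd : Monotone d) (hμ : Monotone μ)
    (hdeg : ∃ e : Fin n ≃ Fin n, ∀ i, d i = (G.degree (e i) : ℝ))
    (heig : ∃ f : Fin n ≃ Fin n, ∀ i, μ i = hL.eigenvalues (f i)) :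
    ∀ i, μ i ≤ 2 * d i := by
  obtain ⟨e, he⟩ := hdeg
  obtain ⟨f, hf⟩ := heig
  intro i
  -- The zero row `i` makes `M` singular; a kernel vector is a suitable test vector.
  let M : Matrix (Fin n) (Fin n) ℝ := fun j =>
    if j < i then (hL.eigenvectorBasis (f j)).ofLp else if i < j then Pi.single (e j) 1 else 0
  have hdet : M.det = 0 := det_eq_zero_of_row_eq_zero i fun k => by simp [M]
  obtain ⟨x, hx0, hx⟩ := exists_mulVec_eq_zero_iff.mpr hdet
  have horth : ∀ j < i, (hL.eigenvectorBasis (f j)).ofLp ⬝ᵥ x = 0 := by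
    intro j hj
    simpa [M, mulVec, hj] using congrFun hx j
  have hsupp : ∀ j, i < j → x (e j) = 0 := by
    intro j hj
    simpa [M, mulVec, hj, hj.not_gt] using congrFun hx j
  have hlow : μ i * (x ⬝ᵥ x) ≤ x ⬝ᵥ G.lapMatrix ℝ *ᵥ x := by
    refine hL.mul_dotProduct_self_le fun j hj => ?_
    obtain ⟨j, rfl⟩ := f.surjective j
    rw [← hf] at hj
    exact horth j (hμ.reflect_lt hj)
  have hup : ∑ k, 2 * (G.degree k : ℝ) * x k ^ 2 ≤ 2 * d i * (x ⬝ᵥ x) := by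
    rw [dotProduct, Finset.mul_sum]
    refine Finset.sum_le_sum fun k _ => ?_
    obtain ⟨j, rfl⟩ := e.surjective k
    rw [← he, ← sq]
    rcases lt_or_ge i j with hj | hj
    · simp [hsupp j hj]
    · have := hd hj
      gcongr
  have hpos : 0 < x ⬝ᵥ x := by
    simpa using dotProduct_star_self_pos_iff.mpr hx0
  exact le_of_mul_le_mul_right
    ((hlow.trans (G.dotProduct_lapMatrix_mulVec_le x)).trans hup) hpos
end

section
/- Let S₁ and S₂ be finite simple graphs, each with all vertex degrees positive, with normalized Laplacians 𝓛_{S₁} and 𝓛_{S₂}. If v is an eigenvector of 𝓛_{S₁} with eigenvalue λ and u is an eigenvector of 𝓛_{S₂} with eigenvalue κ, then v ⊗ u is an eigenvector of the normalized Laplacian 𝓛_{S₁⊗S₂} of the Kronecker product graph with eigenvalue 1 − (1−λ)(1−κ). -/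
open Matrix Kronecker

/-- The normalized Laplacian `𝓛 = I - D^{-1/2} A D^{-1/2}` of a simple graph. -/
noncomputable def normLap {α : Type*} [Fintype α] [DecidableEq α]
    (G : SimpleGraph α) [DecidableRel G.Adj] : Matrix α α ℝ :=
  1 - (Matrix.diagonal fun v => (Real.sqrt (G.degree v : ℝ))⁻¹) * G.adjMatrix ℝ
      * (Matrix.diagonal fun v => (Real.sqrt (G.degree v : ℝ))⁻¹)

/-- A Kronecker product of matrices acts factorwise on a Kronecker product of vectors. -/
theorem kronecker_mulVec_kronecker {α β : Type*} [Fintype α] [Fintype β]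
    (M : Matrix α α ℝ) (N : Matrix β β ℝ) (v : α → ℝ) (u : β → ℝ) :
    (M ⊗ₖ N) *ᵥ (fun p : α × β => v p.1 * u p.2) =
      fun p => (M *ᵥ v) p.1 * (N *ᵥ u) p.2 := by
  ext p
  simp only [mulVec, dotProduct, Finset.sum_mul_sum, Fintype.sum_prod_type]
  exact Finset.sum_congr rfl fun i _ => Finset.sum_congr rfl fun j _ => mul_mul_mul_comm _ _ _ _

/-- An eigenvector of `1 - M` with eigenvalue `c` is scaled by `1 - c` under `M`. -/
theorem mulVec_eq_of_one_sub_mulVec_eq {α : Type*} [Fintype α] [DecidableEq α]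
    {M : Matrix α α ℝ} {v : α → ℝ} {c : ℝ} (h : (1 - M) *ᵥ v = c • v) :
    M *ᵥ v = (1 - c) • v := by
  rw [sub_mulVec, one_mulVec] at h
  rw [sub_smul, one_smul, ← h, sub_sub_cancel]

/-- If `v` is an eigenvector of `𝓛_G` with eigenvalue `λ` and `u` is an eigenvector of
`𝓛_H` with eigenvalue `κ` (degrees of `G` and `H` all positive), then `v ⊗ u` is an
eigenvector of the normalized Laplacian of the Kronecker product graph with eigenvalue
`1 - (1 - λ) * (1 - κ)`. -/
theorem normLap_kron_eigenvector
    {α β : Type*} [Fintype α] [Fintype β] [DecidableEq α] [DecidableEq β]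
    (G : SimpleGraph α) (H : SimpleGraph β) [DecidableRel G.Adj] [DecidableRel H.Adj]
    (hG : ∀ w, 0 < G.degree w) (hH : ∀ w, 0 < H.degree w)
    (v : α → ℝ) (u : β → ℝ) (lam kap : ℝ)
    (hv : v ≠ 0) (hu : u ≠ 0)
    (hvl : normLap G *ᵥ v = lam • v) (huk : normLap H *ᵥ u = kap • u) :
    (fun p : α × β => v p.1 * u p.2) ≠ 0
      ∧ ((1 : Matrix (α × β) (α × β) ℝ)
            - (Matrix.diagonal fun p : α × β =>
                  (Real.sqrt ((G.degree p.1 : ℝ) * (H.degree p.2 : ℝ)))⁻¹)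
              * (G.adjMatrix ℝ ⊗ₖ H.adjMatrix ℝ)
              * (Matrix.diagonal fun p : α × β =>
                  (Real.sqrt ((G.degree p.1 : ℝ) * (H.degree p.2 : ℝ)))⁻¹))
          *ᵥ (fun p : α × β => v p.1 * u p.2)
        = (1 - (1 - lam) * (1 - kap)) • fun p : α × β => v p.1 * u p.2 := by
  constructor
  · obtain ⟨a, ha⟩ := Function.ne_iff.mp hv
    obtain ⟨b, hb⟩ := Function.ne_iff.mp hu
    exact Function.ne_iff.mpr ⟨(a, b), mul_ne_zero ha hb⟩
  · have hD : (Matrix.diagonal fun p : α × β =>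
          (Real.sqrt ((G.degree p.1 : ℝ) * (H.degree p.2 : ℝ)))⁻¹) =
        (Matrix.diagonal fun a => (Real.sqrt (G.degree a : ℝ))⁻¹) ⊗ₖ
          (Matrix.diagonal fun b => (Real.sqrt (H.degree b : ℝ))⁻¹) := by
      simp only [diagonal_kronecker_diagonal, Real.sqrt_mul (Nat.cast_nonneg _), mul_inv]
    rw [hD, ← mul_kronecker_mul, ← mul_kronecker_mul, sub_mulVec, one_mulVec,
      kronecker_mulVec_kronecker, mulVec_eq_of_one_sub_mulVec_eq hvl,
      mulVec_eq_of_one_sub_mulVec_eq huk]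
    ext p
    simp only [Pi.sub_apply, Pi.smul_apply, smul_eq_mul]
    ring
end

section
/- Let S₁ be a finite simple graph on n₁ vertices with degree vector (d_1^{S₁}, …, d_{n₁}^{S₁}), and let S₂ be a finite simple graph. If w is an eigenvector of the Laplacian L_{S₂} with eigenvalue μ, then L_{S₁⊗S₂}(1_{S₁} ⊗ w) = μ · ([d_1^{S₁}, …, d_{n₁}^{S₁}]^T ⊗ w), where 1_{S₁} is the all-ones vector of length n₁. -/
open Matrix Kronecker

/-- The Kronecker product of matrices acts factorwise on the tensor product of two vectors. -/
theorem kronecker_mulVec_tensor {R l m n p : Type*} [CommSemiring R] [Fintype m] [Fintype p]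
    (A : Matrix l m R) (B : Matrix n p R) (v : m → R) (w : p → R) :
    (A ⊗ₖ B) *ᵥ (fun q : m × p => v q.1 * w q.2) =
      fun q : l × n => (A *ᵥ v) q.1 * (B *ᵥ w) q.2 := by
  ext q
  simp only [mulVec, dotProduct, kroneckerMap_apply, Fintype.sum_prod_type, Finset.sum_mul_sum,
    mul_mul_mul_comm]

/-- If `w` is an eigenvector of the Laplacian `L_H` with eigenvalue `μ`, then
`L_{G⊗H} (1_G ⊗ w) = μ • (d^G ⊗ w)`, where `d^G` is the vector of degrees of `G`
and `L_{G⊗H} = D_G ⊗ D_H - A_G ⊗ A_H`. -/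
theorem lapMatrix_kron_mulVec_ones_tensor_eigvec
    {α β : Type*} [Fintype α] [Fintype β] [DecidableEq α] [DecidableEq β]
    (G : SimpleGraph α) (H : SimpleGraph β) [DecidableRel G.Adj] [DecidableRel H.Adj]
    (w : β → ℝ) (μ : ℝ) (hw0 : w ≠ 0) (hw : H.lapMatrix ℝ *ᵥ w = μ • w) :
    ((Matrix.diagonal fun i => (G.degree i : ℝ)) ⊗ₖ
        (Matrix.diagonal fun j => (H.degree j : ℝ))
      - G.adjMatrix ℝ ⊗ₖ H.adjMatrix ℝ) *ᵥ (fun p : α × β => 1 * w p.2)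
      = μ • fun p : α × β => (G.degree p.1 : ℝ) * w p.2 := by
  have h_one : G.adjMatrix ℝ *ᵥ (fun _ => 1) = fun i => (G.degree i : ℝ) := by
    ext i
    simp [SimpleGraph.adjMatrix_mulVec_apply]
  rw [sub_mulVec, kronecker_mulVec_tensor _ _ (fun _ => 1) w,
    kronecker_mulVec_tensor _ _ (fun _ => 1) w, h_one]
  ext ⟨i, j⟩
  have hj := congrFun hw j
  simp only [SimpleGraph.lapMatrix, SimpleGraph.degMatrix, sub_mulVec, Pi.sub_apply,
    mulVec_diagonal, Pi.smul_apply, smul_eq_mul] at hj ⊢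
  linear_combination (G.degree i : ℝ) * hj
end

section
/- Let S₁ be a finite simple graph on n₁ vertices with all degrees d_1^{S₁}, …, d_{n₁}^{S₁} positive, and let S₂ be a finite simple graph on n₂ vertices with adjacency matrix A_{S₂} and Laplacian L_{S₂}. Let v ∈ ℝ^{n₂} be any vector with v^T A_{S₂} v ≥ 0. Then ⟨L_{S₁⊗S₂}(D_{S₁}^{1/2}1_{S₁} ⊗ v), D_{S₁}^{1/2}1_{S₁} ⊗ v⟩ ≥ (d_1^{S₁}² + ⋯ + d_{n₁}^{S₁}²) · (v^T L_{S₂} v). Moreover, if S₁ is regular (all its degrees equal), then equality holds. -/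
open Matrix Kronecker Finset

theorem kronecker_mulVec_tensor_dotProduct {R α β : Type*} [CommSemiring R] [Fintype α] [Fintype β]
    (A : Matrix α α R) (B : Matrix β β R) (s : α → R) (v : β → R) :
    ((A ⊗ₖ B) *ᵥ (fun p : α × β => s p.1 * v p.2)) ⬝ᵥ (fun p : α × β => s p.1 * v p.2)
      = (s ⬝ᵥ (A *ᵥ s)) * (v ⬝ᵥ (B *ᵥ v)) := by
  have h (i : α) (j : β) : ((A ⊗ₖ B) *ᵥ (fun p : α × β => s p.1 * v p.2)) (i, j)
      = (A *ᵥ s) i * (B *ᵥ v) j := by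
    simp only [mulVec, dotProduct, Fintype.sum_prod_type, kroneckerMap_apply,
      Fintype.sum_mul_sum]
    exact Finset.sum_congr rfl fun _ _ => Finset.sum_congr rfl fun _ _ => by ring
  simp only [dotProduct, Fintype.sum_prod_type, h, Fintype.sum_mul_sum]
  exact Finset.sum_congr rfl fun _ _ => Finset.sum_congr rfl fun _ _ => by ring

/-- For `G` with all degrees positive and any vector `v` with `vᵀ A_H v ≥ 0`,
`⟨L_{G⊗H}(D_G^{1/2} 1_G ⊗ v), D_G^{1/2} 1_G ⊗ v⟩ ≥ (∑ i, d_i²) · (vᵀ L_H v)`,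
with equality when `G` is regular.  Here `L_{G⊗H} = D_G ⊗ D_H - A_G ⊗ A_H`. -/
theorem inner_lapKron_sqrtDeg_tensor_ge
    {α β : Type*} [Fintype α] [Fintype β] [DecidableEq α] [DecidableEq β]
    (G : SimpleGraph α) (H : SimpleGraph β) [DecidableRel G.Adj] [DecidableRel H.Adj]
    (hG : ∀ i, 0 < G.degree i)
    (v : β → ℝ) (hv : 0 ≤ v ⬝ᵥ (H.adjMatrix ℝ *ᵥ v)) :
    (∑ i, (G.degree i : ℝ) ^ 2) * (v ⬝ᵥ (H.lapMatrix ℝ *ᵥ v))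
        ≤ ((( (Matrix.diagonal fun i => (G.degree i : ℝ)) ⊗ₖ
              (Matrix.diagonal fun j => (H.degree j : ℝ))
            - G.adjMatrix ℝ ⊗ₖ H.adjMatrix ℝ)
            *ᵥ (fun p : α × β => Real.sqrt (G.degree p.1 : ℝ) * v p.2))
          ⬝ᵥ (fun p : α × β => Real.sqrt (G.degree p.1 : ℝ) * v p.2))
      ∧ ((∀ i j, G.degree i = G.degree j) →
          ((( (Matrix.diagonal fun i => (G.degree i : ℝ)) ⊗ₖ
              (Matrix.diagonal fun j => (H.degree j : ℝ))
            - G.adjMatrix ℝ ⊗ₖ H.adjMatrix ℝ)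
            *ᵥ (fun p : α × β => Real.sqrt (G.degree p.1 : ℝ) * v p.2))
          ⬝ᵥ (fun p : α × β => Real.sqrt (G.degree p.1 : ℝ) * v p.2))
            = (∑ i, (G.degree i : ℝ) ^ 2) * (v ⬝ᵥ (H.lapMatrix ℝ *ᵥ v))) := by
  set s : α → ℝ := fun i => Real.sqrt (G.degree i : ℝ) with hs
  have hlap : 0 ≤ s ⬝ᵥ (G.lapMatrix ℝ *ᵥ s) := by
    simpa using (G.posSemidef_lapMatrix ℝ).dotProduct_mulVec_nonneg s
  have hdeg : s ⬝ᵥ ((Matrix.diagonal fun i => (G.degree i : ℝ)) *ᵥ s)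
      = ∑ i, (G.degree i : ℝ) ^ 2 := by
    simp only [dotProduct, mulVec_diagonal]
    refine Finset.sum_congr rfl fun i _ => ?_
    have hsq : s i * s i = G.degree i := Real.mul_self_sqrt (Nat.cast_nonneg _)
    linear_combination (G.degree i : ℝ) * hsq
  have hG_lap : s ⬝ᵥ (G.lapMatrix ℝ *ᵥ s)
      = ∑ i, (G.degree i : ℝ) ^ 2 - s ⬝ᵥ (G.adjMatrix ℝ *ᵥ s) := by
    rw [← hdeg, ← dotProduct_sub, ← sub_mulVec]
    rfl
  have hH_lap : v ⬝ᵥ (H.lapMatrix ℝ *ᵥ v)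
      = v ⬝ᵥ ((Matrix.diagonal fun j => (H.degree j : ℝ)) *ᵥ v)
        - v ⬝ᵥ (H.adjMatrix ℝ *ᵥ v) := by
    rw [← dotProduct_sub, ← sub_mulVec]
    rfl
  rw [sub_mulVec, sub_dotProduct, kronecker_mulVec_tensor_dotProduct _ _ s v,
    kronecker_mulVec_tensor_dotProduct _ _ s v, hdeg, hH_lap]
  refine ⟨by nlinarith [mul_nonneg hlap hv], fun hreg => ?_⟩
  have hzero : G.lapMatrix ℝ *ᵥ s = 0 :=
    (G.lapMatrix_mulVec_eq_zero_iff_forall_adj).2 fun i j _ => by simp only [hs, hreg i j]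
  rw [hzero, dotProduct_zero] at hG_lap
  linear_combination -(v ⬝ᵥ (H.adjMatrix ℝ *ᵥ v)) * hG_lap
end

section
/- Let S₁ be a finite simple graph on n₁ vertices with all degrees d_1^{S₁}, …, d_{n₁}^{S₁} positive, and let S₂ be a finite simple graph on n₂ vertices with adjacency matrix A_{S₂} and degree matrix D_{S₂}. Then for every vector v ∈ ℝ^{n₂}, ‖L_{S₁⊗S₂}(D_{S₁}^{1/2}1_{S₁} ⊗ v)‖ ≤ √(d_1^{S₁}³ + ⋯ + d_{n₁}^{S₁}³) · (‖D_{S₂}v‖ + ‖A_{S₂}v‖). -/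
open Matrix Kronecker Finset

theorem sqrt_dotProduct_self_eq_norm {ι : Type*} [Fintype ι] (x : ι → ℝ) :
    Real.sqrt (x ⬝ᵥ x) = ‖WithLp.toLp 2 x‖ := by
  simp [EuclideanSpace.norm_eq, dotProduct, sq]

theorem sqrt_dotProduct_self_sub_le {ι : Type*} [Fintype ι] (x y : ι → ℝ) :
    Real.sqrt ((x - y) ⬝ᵥ (x - y)) ≤ Real.sqrt (x ⬝ᵥ x) + Real.sqrt (y ⬝ᵥ y) := by
  simpa only [sqrt_dotProduct_self_eq_norm, WithLp.toLp_sub] using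
    norm_sub_le (WithLp.toLp 2 x) (WithLp.toLp 2 y)

theorem kronecker_mulVec_mul {α β γ δ R : Type*} [Fintype γ] [Fintype δ] [CommSemiring R]
    (A : Matrix α γ R) (B : Matrix β δ R) (x : γ → R) (y : δ → R) :
    (A ⊗ₖ B) *ᵥ (fun p : γ × δ => x p.1 * y p.2) = fun p => (A *ᵥ x) p.1 * (B *ᵥ y) p.2 := by
  ext p
  simp only [mulVec, dotProduct, kroneckerMap_apply, Fintype.sum_prod_type, sum_mul_sum]
  exact sum_congr rfl fun i _ => sum_congr rfl fun j _ => by ring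

theorem dotProduct_mul_mul {α β R : Type*} [Fintype α] [Fintype β] [CommSemiring R]
    (x z : α → R) (y w : β → R) :
    (fun p : α × β => x p.1 * y p.2) ⬝ᵥ (fun p : α × β => z p.1 * w p.2) =
      (x ⬝ᵥ z) * (y ⬝ᵥ w) := by
  simp only [dotProduct, Fintype.sum_prod_type, sum_mul_sum]
  exact sum_congr rfl fun i _ => sum_congr rfl fun j _ => by ring

theorem sqrt_dotProduct_mul_self {α β : Type*} [Fintype α] [Fintype β] (x : α → ℝ) (y : β → ℝ) :
    Real.sqrt ((fun p : α × β => x p.1 * y p.2) ⬝ᵥ (fun p : α × β => x p.1 * y p.2)) =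
      Real.sqrt (x ⬝ᵥ x) * Real.sqrt (y ⬝ᵥ y) := by
  rw [dotProduct_mul_mul,
    Real.sqrt_mul (show 0 ≤ x ⬝ᵥ x from sum_nonneg fun i _ => mul_self_nonneg (x i))]

namespace SimpleGraph

variable {α : Type*} [Fintype α] (G : SimpleGraph α) [DecidableRel G.Adj]

theorem sum_sum_neighborFinset_comm (f : α → α → ℝ) :
    ∑ i, ∑ j ∈ G.neighborFinset i, f i j = ∑ i, ∑ j ∈ G.neighborFinset i, f j i :=
  sum_comm' fun i j => by simp [G.adj_comm]

theorem sum_sum_neighborFinset_degree_mul_le :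
    ∑ i, ∑ j ∈ G.neighborFinset i, (G.degree i : ℝ) * G.degree j ≤
      ∑ i, (G.degree i : ℝ) ^ 3 := by
  have h_sum : ∑ i, ∑ _j ∈ G.neighborFinset i, (G.degree i : ℝ) ^ 2 =
      ∑ i, (G.degree i : ℝ) ^ 3 :=
    sum_congr rfl fun i _ => by
      rw [sum_const, card_neighborFinset_eq_degree, nsmul_eq_mul]; ring
  calc ∑ i, ∑ j ∈ G.neighborFinset i, (G.degree i : ℝ) * G.degree j
      ≤ ∑ i, ∑ j ∈ G.neighborFinset i,
          ((G.degree i : ℝ) ^ 2 / 2 + (G.degree j : ℝ) ^ 2 / 2) := by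
        gcongr with i _ j _
        linarith [two_mul_le_add_sq (G.degree i : ℝ) (G.degree j)]
    _ = ∑ i, (G.degree i : ℝ) ^ 3 := by
        simp only [sum_add_distrib]
        rw [G.sum_sum_neighborFinset_comm fun _ j => (G.degree j : ℝ) ^ 2 / 2]
        simp only [← sum_div]
        rw [h_sum, add_halves]

theorem adjMatrix_mulVec_sqrt_degree_dotProduct_self_le :
    (G.adjMatrix ℝ *ᵥ fun i => Real.sqrt (G.degree i)) ⬝ᵥ
        (G.adjMatrix ℝ *ᵥ fun i => Real.sqrt (G.degree i)) ≤
      ∑ i, (G.degree i : ℝ) ^ 3 := by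
  refine le_trans (sum_le_sum fun i _ => ?_) G.sum_sum_neighborFinset_degree_mul_le
  rw [adjMatrix_mulVec_apply, ← sq, ← mul_sum]
  refine sq_sum_le_card_mul_sum_sq.trans_eq ?_
  rw [card_neighborFinset_eq_degree]
  simp

theorem diagonal_degree_mulVec_sqrt_degree_dotProduct_self [DecidableEq α] :
    ((diagonal fun i => (G.degree i : ℝ)) *ᵥ fun i => Real.sqrt (G.degree i)) ⬝ᵥ
        ((diagonal fun i => (G.degree i : ℝ)) *ᵥ fun i => Real.sqrt (G.degree i)) =
      ∑ i, (G.degree i : ℝ) ^ 3 := by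
  refine sum_congr rfl fun i _ => ?_
  rw [mulVec_diagonal, mul_mul_mul_comm, Real.mul_self_sqrt (Nat.cast_nonneg _)]
  ring

end SimpleGraph

/-- For `G` with all degrees positive and any vector `v`,
`‖L_{G⊗H}(D_G^{1/2} 1_G ⊗ v)‖ ≤ √(∑ i, d_i³) · (‖D_H v‖ + ‖A_H v‖)`,
where the norm is the Euclidean norm and `L_{G⊗H} = D_G ⊗ D_H - A_G ⊗ A_H`. -/
theorem norm_lapKron_sqrtDeg_tensor_le
    {α β : Type*} [Fintype α] [Fintype β] [DecidableEq α] [DecidableEq β]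
    (G : SimpleGraph α) (H : SimpleGraph β) [DecidableRel G.Adj] [DecidableRel H.Adj]
    (hG : ∀ i, 0 < G.degree i) (v : β → ℝ) :
    Real.sqrt
        (((( (Matrix.diagonal fun i => (G.degree i : ℝ)) ⊗ₖ
              (Matrix.diagonal fun j => (H.degree j : ℝ))
            - G.adjMatrix ℝ ⊗ₖ H.adjMatrix ℝ)
            *ᵥ (fun p : α × β => Real.sqrt (G.degree p.1 : ℝ) * v p.2))
          ⬝ᵥ ((( (Matrix.diagonal fun i => (G.degree i : ℝ)) ⊗ₖ
              (Matrix.diagonal fun j => (H.degree j : ℝ))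
            - G.adjMatrix ℝ ⊗ₖ H.adjMatrix ℝ)
            *ᵥ (fun p : α × β => Real.sqrt (G.degree p.1 : ℝ) * v p.2)))))
      ≤ Real.sqrt (∑ i, (G.degree i : ℝ) ^ 3)
          * (Real.sqrt (((Matrix.diagonal fun j => (H.degree j : ℝ)) *ᵥ v)
                ⬝ᵥ ((Matrix.diagonal fun j => (H.degree j : ℝ)) *ᵥ v))
            + Real.sqrt ((H.adjMatrix ℝ *ᵥ v) ⬝ᵥ (H.adjMatrix ℝ *ᵥ v))) := by
  rw [sub_mulVec,
    kronecker_mulVec_mul _ _ (fun i => Real.sqrt (G.degree i : ℝ)),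
    kronecker_mulVec_mul _ _ (fun i => Real.sqrt (G.degree i : ℝ))]
  refine (sqrt_dotProduct_self_sub_le _ _).trans ?_
  rw [sqrt_dotProduct_mul_self, sqrt_dotProduct_mul_self,
    G.diagonal_degree_mulVec_sqrt_degree_dotProduct_self, mul_add]
  gcongr
  exact G.adjMatrix_mulVec_sqrt_degree_dotProduct_self_le
end

section
/- Let S₁ be a finite simple graph on n₁ vertices with all degrees d_1^{S₁}, …, d_{n₁}^{S₁} positive, and let S₂ be a finite simple graph on n₂ vertices with adjacency matrix A_{S₂}, degree matrix D_{S₂}, and Laplacian L_{S₂}. Let v ∈ ℝ^{n₂} be a nonzero vector with v^T A_{S₂} v ≥ 0, and suppose L_{S₁⊗S₂}(D_{S₁}^{1/2}1_{S₁} ⊗ v) ≠ 0. Then the correlation coefficient between L_{S₁⊗S₂}(D_{S₁}^{1/2}1_{S₁} ⊗ v) and D_{S₁}^{1/2}1_{S₁} ⊗ v is at least ((d_1^{S₁}² + ⋯ + d_{n₁}^{S₁}²) / √((d_1^{S₁}³ + ⋯ + d_{n₁}^{S₁}³)(d_1^{S₁} + ⋯ + d_{n₁}^{S₁}))) · (v^T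 L_{S₂} v) / ((‖D_{S₂}v‖ + ‖A_{S₂}v‖)·‖v‖). -/
open Matrix Kronecker Finset

/-- The Laplacian of the Kronecker product of graphs, `L_{G⊗H} = D_G ⊗ D_H - A_G ⊗ A_H`. -/
noncomputable def lapKron {α β : Type*} [Fintype α] [Fintype β] [DecidableEq α] [DecidableEq β]
    (G : SimpleGraph α) (H : SimpleGraph β) [DecidableRel G.Adj] [DecidableRel H.Adj] :
    Matrix (α × β) (α × β) ℝ :=
  (Matrix.diagonal fun i => (G.degree i : ℝ)) ⊗ₖ (Matrix.diagonal fun j => (H.degree j : ℝ))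
    - G.adjMatrix ℝ ⊗ₖ H.adjMatrix ℝ

/-- The correlation coefficient `⟨u,w⟩/(‖u‖·‖w‖)` of two vectors (cosine of their angle),
with the standard Euclidean inner product and norm. -/
noncomputable def corrCoeff {ι : Type*} [Fintype ι] (u w : ι → ℝ) : ℝ :=
  (u ⬝ᵥ w) / (Real.sqrt (u ⬝ᵥ u) * Real.sqrt (w ⬝ᵥ w))

section Auxiliary

variable {α β : Type*} [Fintype α] [Fintype β]

theorem kronecker_mulVec_tensor_s15 (M : Matrix α α ℝ) (N : Matrix β β ℝ) (x : α → ℝ) (v : β → ℝ) :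
    (M ⊗ₖ N) *ᵥ (fun p : α × β => x p.1 * v p.2) = fun p => (M *ᵥ x) p.1 * (N *ᵥ v) p.2 := by
  ext p
  simp only [mulVec, dotProduct, Fintype.sum_prod_type, kroneckerMap_apply, Finset.sum_mul_sum]
  refine Finset.sum_congr rfl fun i _ => Finset.sum_congr rfl fun j _ => ?_
  ring

theorem tensor_dotProduct_tensor (x y : α → ℝ) (v w : β → ℝ) :
    (fun p : α × β => x p.1 * v p.2) ⬝ᵥ (fun p => y p.1 * w p.2) = (x ⬝ᵥ y) * (v ⬝ᵥ w) := by
  simp only [dotProduct, Fintype.sum_prod_type, Finset.sum_mul_sum]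
  refine Finset.sum_congr rfl fun i _ => Finset.sum_congr rfl fun j _ => ?_
  ring

theorem sqrt_dotProduct_self_eq_norm_s15 (u : α → ℝ) :
    Real.sqrt (u ⬝ᵥ u) = ‖WithLp.toLp 2 u‖ := by
  simp [EuclideanSpace.norm_eq, dotProduct, sq]

theorem sqrt_dotProduct_self_sub_le_s15 (u w : α → ℝ) :
    Real.sqrt ((u - w) ⬝ᵥ (u - w)) ≤ Real.sqrt (u ⬝ᵥ u) + Real.sqrt (w ⬝ᵥ w) := by
  simp only [sqrt_dotProduct_self_eq_norm_s15, WithLp.toLp_sub]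
  exact norm_sub_le _ _

variable [DecidableEq α] (G : SimpleGraph α) [DecidableRel G.Adj]

/-- The quadratic form of the adjacency matrix is dominated by that of the degree matrix. -/
theorem dotProduct_adjMatrix_mulVec_le (x : α → ℝ) :
    x ⬝ᵥ (G.adjMatrix ℝ *ᵥ x) ≤ ∑ i, (G.degree i : ℝ) * x i ^ 2 := by
  have h := (G.posSemidef_lapMatrix ℝ).dotProduct_mulVec_nonneg x
  rw [SimpleGraph.lapMatrix, sub_mulVec, dotProduct_sub] at h
  have h2 : x ⬝ᵥ (G.degMatrix ℝ *ᵥ x) = ∑ i, (G.degree i : ℝ) * x i ^ 2 := by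
    simp only [SimpleGraph.degMatrix, dotProduct, mulVec_diagonal]
    exact Finset.sum_congr rfl fun i _ => by ring
  simp only [star_trivial] at h
  linarith

/-- The vector `A_G D_G^{1/2} 1` has squared norm at most `∑ d_i³`. -/
theorem adjMatrix_mulVec_sqrt_degree_dotProduct_self_le :
    (G.adjMatrix ℝ *ᵥ fun i => Real.sqrt (G.degree i : ℝ)) ⬝ᵥ
      (G.adjMatrix ℝ *ᵥ fun i => Real.sqrt (G.degree i : ℝ)) ≤ ∑ i, (G.degree i : ℝ) ^ 3 := by
  calc _ ≤ (fun i => (G.degree i : ℝ)) ⬝ᵥ (G.adjMatrix ℝ *ᵥ fun i => (G.degree i : ℝ)) := by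
        refine Finset.sum_le_sum fun i _ => ?_
        simp only [SimpleGraph.adjMatrix_mulVec_apply]
        have h := sq_sum_le_card_mul_sum_sq (s := G.neighborFinset i)
          (f := fun j => Real.sqrt (G.degree j : ℝ))
        simp only [Nat.cast_nonneg, Real.sq_sqrt, SimpleGraph.card_neighborFinset_eq_degree] at h
        rwa [← sq]
    _ ≤ _ := (dotProduct_adjMatrix_mulVec_le G _).trans_eq
        (Finset.sum_congr rfl fun i _ => by ring)

end Auxiliary

/-- Lower bound for the correlation coefficient between `L_{G⊗H}(D_G^{1/2} 1_G ⊗ v)` and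
`D_G^{1/2} 1_G ⊗ v`: for `G` with all degrees positive and `v ≠ 0` with `vᵀ A_H v ≥ 0`
and `L_{G⊗H}(D_G^{1/2} 1_G ⊗ v) ≠ 0`, the correlation coefficient is at least
`((∑ d_i²)/√((∑ d_i³)(∑ d_i))) · (vᵀ L_H v)/((‖D_H v‖ + ‖A_H v‖)·‖v‖)`. -/
theorem corr_lapKron_sqrtDeg_tensor_ge
    {α β : Type*} [Fintype α] [Fintype β] [DecidableEq α] [DecidableEq β]
    (G : SimpleGraph α) (H : SimpleGraph β) [DecidableRel G.Adj] [DecidableRel H.Adj]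
    (hG : ∀ i, 0 < G.degree i)
    (v : β → ℝ) (hv0 : v ≠ 0) (hvA : 0 ≤ v ⬝ᵥ (H.adjMatrix ℝ *ᵥ v))
    (hL0 : lapKron G H *ᵥ (fun p : α × β => Real.sqrt (G.degree p.1 : ℝ) * v p.2) ≠ 0) :
    ((∑ i, (G.degree i : ℝ) ^ 2)
          / Real.sqrt ((∑ i, (G.degree i : ℝ) ^ 3) * (∑ i, (G.degree i : ℝ))))
        * ((v ⬝ᵥ (H.lapMatrix ℝ *ᵥ v))
          / ((Real.sqrt (((Matrix.diagonal fun j => (H.degree j : ℝ)) *ᵥ v)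
                ⬝ᵥ ((Matrix.diagonal fun j => (H.degree j : ℝ)) *ᵥ v))
              + Real.sqrt ((H.adjMatrix ℝ *ᵥ v) ⬝ᵥ (H.adjMatrix ℝ *ᵥ v)))
            * Real.sqrt (v ⬝ᵥ v)))
      ≤ corrCoeff
          (lapKron G H *ᵥ (fun p : α × β => Real.sqrt (G.degree p.1 : ℝ) * v p.2))
          (fun p : α × β => Real.sqrt (G.degree p.1 : ℝ) * v p.2) := by
  set x : α → ℝ := fun i => Real.sqrt (G.degree i : ℝ) with hx
  set DG : Matrix α α ℝ := Matrix.diagonal fun i => (G.degree i : ℝ) with hDG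
  set DH : Matrix β β ℝ := Matrix.diagonal fun j => (H.degree j : ℝ) with hDH
  have hx2 : ∀ i, x i * x i = G.degree i := fun i => Real.mul_self_sqrt (Nat.cast_nonneg _)
  set a : α × β → ℝ := fun p => (DG *ᵥ x) p.1 * (DH *ᵥ v) p.2 with ha
  set b : α × β → ℝ := fun p => (G.adjMatrix ℝ *ᵥ x) p.1 * (H.adjMatrix ℝ *ᵥ v) p.2 with hb
  have hL : lapKron G H *ᵥ (fun p : α × β => x p.1 * v p.2) = a - b := by
    rw [lapKron, sub_mulVec, kronecker_mulVec_tensor_s15, kronecker_mulVec_tensor_s15]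
  have hxx : x ⬝ᵥ x = ∑ i, (G.degree i : ℝ) := Finset.sum_congr rfl fun i _ => hx2 i
  have hDx : (DG *ᵥ x) ⬝ᵥ x = ∑ i, (G.degree i : ℝ) ^ 2 := by
    refine Finset.sum_congr rfl fun i _ => ?_
    rw [hDG, mulVec_diagonal, mul_assoc, hx2, sq]
  have hDx2 : (DG *ᵥ x) ⬝ᵥ (DG *ᵥ x) = ∑ i, (G.degree i : ℝ) ^ 3 := by
    refine Finset.sum_congr rfl fun i _ => ?_
    rw [hDG, mulVec_diagonal, mul_mul_mul_comm, hx2]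
    ring
  have hAx : (G.adjMatrix ℝ *ᵥ x) ⬝ᵥ x ≤ ∑ i, (G.degree i : ℝ) ^ 2 := by
    rw [dotProduct_comm]
    refine (dotProduct_adjMatrix_mulVec_le G x).trans_eq (Finset.sum_congr rfl fun i _ => ?_)
    rw [sq, hx2, sq]
  have hAx2 := adjMatrix_mulVec_sqrt_degree_dotProduct_self_le G
  have hlap : v ⬝ᵥ (H.lapMatrix ℝ *ᵥ v) = (DH *ᵥ v) ⬝ᵥ v - (H.adjMatrix ℝ *ᵥ v) ⬝ᵥ v := by
    rw [SimpleGraph.lapMatrix, sub_mulVec, dotProduct_sub, dotProduct_comm v,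
      dotProduct_comm v, SimpleGraph.degMatrix]
  have hlap0 : 0 ≤ v ⬝ᵥ (H.lapMatrix ℝ *ᵥ v) := by
    simpa using (H.posSemidef_lapMatrix ℝ).dotProduct_mulVec_nonneg v
  have hnum : (∑ i, (G.degree i : ℝ) ^ 2) * (v ⬝ᵥ (H.lapMatrix ℝ *ᵥ v))
      ≤ (a - b) ⬝ᵥ (fun p : α × β => x p.1 * v p.2) := by
    rw [sub_dotProduct, ha, hb, tensor_dotProduct_tensor, tensor_dotProduct_tensor, hDx, hlap,
      mul_sub]
    rw [dotProduct_comm] at hvA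
    exact sub_le_sub_left (mul_le_mul_of_nonneg_right hAx hvA) _
  have hden : Real.sqrt ((a - b) ⬝ᵥ (a - b)) ≤ Real.sqrt (∑ i, (G.degree i : ℝ) ^ 3) *
      (Real.sqrt ((DH *ᵥ v) ⬝ᵥ (DH *ᵥ v))
        + Real.sqrt ((H.adjMatrix ℝ *ᵥ v) ⬝ᵥ (H.adjMatrix ℝ *ᵥ v))) := by
    refine (sqrt_dotProduct_self_sub_le_s15 a b).trans ?_
    have h3 : (0 : ℝ) ≤ ∑ i, (G.degree i : ℝ) ^ 3 := by positivity
    have h4 : 0 ≤ (G.adjMatrix ℝ *ᵥ x) ⬝ᵥ (G.adjMatrix ℝ *ᵥ x) :=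
      Finset.sum_nonneg fun i _ => mul_self_nonneg _
    rw [ha, hb, tensor_dotProduct_tensor, tensor_dotProduct_tensor, hDx2, Real.sqrt_mul h3,
      Real.sqrt_mul h4, mul_add]
    gcongr
  have hpos : ∀ u : α × β → ℝ, u ≠ 0 → 0 < Real.sqrt (u ⬝ᵥ u) := by
    intro u hu
    rw [sqrt_dotProduct_self_eq_norm_s15]
    simpa using hu
  have hxv0 : (fun p : α × β => x p.1 * v p.2) ≠ 0 := by
    intro h
    rw [h, mulVec_zero] at hL0
    exact hL0 rfl
  rw [hL] at hL0 ⊢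
  rw [corrCoeff, div_mul_div_comm]
  refine div_le_div₀ ((mul_nonneg (by positivity) hlap0).trans hnum) hnum
    (mul_pos (hpos _ hL0) (hpos _ hxv0)) ?_
  rw [tensor_dotProduct_tensor x x v v, hxx,
    Real.sqrt_mul (by positivity : (0 : ℝ) ≤ ∑ i, (G.degree i : ℝ)),
    Real.sqrt_mul (by positivity : (0 : ℝ) ≤ ∑ i, (G.degree i : ℝ) ^ 3)]
  calc _ ≤ _ := mul_le_mul_of_nonneg_right hden (by positivity)
    _ = _ := by ring
end

section
/- Let n ≥ 2 be an integer and 0 < p ≤ 1 a real number. Set μ₁ = (n−1)p, μ₂ = (n−1)p(1−p) + (n−1)²p², and μ₃ = (n−1)(n−2)(n−3)p³ + 3(n−1)(n−2)p² + (n−1)p (the first three moments of a Binomial(n−1, p) random variable). Then μ₂² · (1 − p + (n−1)p) ≥ μ₁² · μ₃; equivalently, μ₂ / √(μ₁ μ₃) ≥ √(μ₁ / (1 − p + (n−1)p)). -/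
/-- The third moment of a binomial variable with parameters `m` and `p` is at most
`(1 - p + m p)³`. -/
lemma binomial_third_moment_le_cube {m p : ℝ} (hm : 1 ≤ m) (hp0 : 0 ≤ p) (hp1 : p ≤ 1) :
    m * (m - 1) * (m - 2) * p ^ 3 + 3 * m * (m - 1) * p ^ 2 + m * p ≤
      (1 - p + m * p) ^ 3 := by
  have ht : 0 ≤ (m - 1) * p := mul_nonneg (by linarith) hp0
  have hq : 0 ≤ 1 - p := by linarith
  have h : 0 ≤ (m - 1) * p * ((1 - p) * (2 - p)) :=
    mul_nonneg ht (mul_nonneg hq (by linarith))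
  linear_combination h + hq

/-- The third moment of a nondegenerate binomial variable is positive. -/
lemma binomial_third_moment_pos {m p : ℝ} (hm : 1 ≤ m) (hp0 : 0 < p) (hp1 : p ≤ 1) :
    0 < m * (m - 1) * (m - 2) * p ^ 3 + 3 * m * (m - 1) * p ^ 2 + m * p := by
  have ht : 0 ≤ (m - 1) * p := mul_nonneg (by linarith) hp0.le
  have h : 0 ≤ (m - 1) * p * (3 - p) := mul_nonneg ht (by linarith)
  have hμ₁ : 0 < m * p := mul_pos (by linarith) hp0
  calc 0 < m * p * (((m - 1) * p) ^ 2 + (m - 1) * p * (3 - p) + 1) := by positivity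
    _ = _ := by ring

/-- Moment inequality for Binomial(n-1, p): with `μ₁ = (n-1)p`,
`μ₂ = (n-1)p(1-p) + (n-1)²p²` and
`μ₃ = (n-1)(n-2)(n-3)p³ + 3(n-1)(n-2)p² + (n-1)p`, one has
`μ₂² (1 - p + (n-1)p) ≥ μ₁² μ₃`; equivalently
`μ₂/√(μ₁μ₃) ≥ √(μ₁/(1 - p + (n-1)p))`. -/
theorem binomial_moment_ratio_ineq (n : ℕ) (hn : 2 ≤ n) (p : ℝ) (hp0 : 0 < p) (hp1 : p ≤ 1) :
    (((n : ℝ) - 1) * p * (1 - p) + ((n : ℝ) - 1) ^ 2 * p ^ 2) ^ 2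
          * (1 - p + ((n : ℝ) - 1) * p)
        ≥ (((n : ℝ) - 1) * p) ^ 2
          * (((n : ℝ) - 1) * ((n : ℝ) - 2) * ((n : ℝ) - 3) * p ^ 3
            + 3 * ((n : ℝ) - 1) * ((n : ℝ) - 2) * p ^ 2 + ((n : ℝ) - 1) * p)
      ∧ (((n : ℝ) - 1) * p * (1 - p) + ((n : ℝ) - 1) ^ 2 * p ^ 2)
          / Real.sqrt ((((n : ℝ) - 1) * p)
            * (((n : ℝ) - 1) * ((n : ℝ) - 2) * ((n : ℝ) - 3) * p ^ 3
              + 3 * ((n : ℝ) - 1) * ((n : ℝ) - 2) * p ^ 2 + ((n : ℝ) - 1) * p))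
        ≥ Real.sqrt ((((n : ℝ) - 1) * p) / (1 - p + ((n : ℝ) - 1) * p)) := by
  have hm : (1 : ℝ) ≤ (n : ℝ) - 1 := by
    have : (2 : ℝ) ≤ n := by exact_mod_cast hn
    linarith
  have e2 : (n : ℝ) - 2 = (n : ℝ) - 1 - 1 := by ring
  have e3 : (n : ℝ) - 3 = (n : ℝ) - 1 - 2 := by ring
  rw [e2, e3]
  generalize (n : ℝ) - 1 = m at hm
  have hcube := binomial_third_moment_le_cube hm hp0.le hp1
  have hμ₃ := binomial_third_moment_pos hm hp0 hp1
  set μ₃ := m * (m - 1) * (m - 2) * p ^ 3 + 3 * m * (m - 1) * p ^ 2 + m * p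
  have hμ₁ : 0 < m * p := mul_pos (by linarith) hp0
  have hs : 0 < 1 - p + m * p := by linarith
  have key : (m * p) ^ 2 * μ₃ ≤
      (m * p * (1 - p) + m ^ 2 * p ^ 2) ^ 2 * (1 - p + m * p) :=
    calc (m * p) ^ 2 * μ₃ ≤ (m * p) ^ 2 * (1 - p + m * p) ^ 3 := by gcongr
      _ = _ := by ring
  refine ⟨key, ?_⟩
  have hμ₂ : 0 ≤ m * p * (1 - p) + m ^ 2 * p ^ 2 := by
    have : 0 ≤ 1 - p := by linarith
    positivity
  rw [ge_iff_le, le_div_iff₀ (Real.sqrt_pos.2 (mul_pos hμ₁ hμ₃)),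
    ← Real.sqrt_mul (by positivity)]
  refine Real.sqrt_le_iff.2 ⟨hμ₂, ?_⟩
  rw [div_mul_eq_mul_div, div_le_iff₀ hs]
  linarith [key]
end

section
/- Let μ₁, μ₂ ∈ ℝ, σ₁, σ₂ > 0, and let t ∈ ℝ satisfy t²σ₁²σ₂² < 1. Then (1/(2πσ₁σ₂)) ∫_{ℝ} ∫_{ℝ} exp(−t·x·y) · exp(−(x−μ₁)²/(2σ₁²)) · exp(−(y−μ₂)²/(2σ₂²)) dx dy = exp((−2t·μ₁μ₂ + (μ₁²σ₂² + μ₂²σ₁²)·t²) / (2(1 − t²σ₁²σ₂²))) / √(1 − t²σ₁²σ₂²); that is, for independent Gaussian random variables X ~ N(μ₁, σ₁²) and Y ~ N(μ₂, σ₂²), E[e^{−tXY}] equals the right-hand side. -/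
open MeasureTheory Real

/-- The integral of a real Gaussian with a general quadratic exponent. -/
theorem integral_exp_quadratic {b : ℝ} (hb : 0 < b) (c d : ℝ) :
    ∫ x : ℝ, Real.exp (-b * x ^ 2 + c * x + d) =
      Real.exp (d + c ^ 2 / (4 * b)) * Real.sqrt (Real.pi / b) := by
  have h : ∀ x : ℝ, Real.exp (-b * x ^ 2 + c * x + d) =
      Real.exp (d + c ^ 2 / (4 * b)) * Real.exp (-b * (x - c / (2 * b)) ^ 2) := by
    intro x
    rw [← Real.exp_add]
    congr 1
    field_simp
    ring
  simp_rw [h]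
  rw [integral_const_mul, integral_sub_right_eq_self (fun x : ℝ => Real.exp (-b * x ^ 2)),
    integral_gaussian]

/-- For independent Gaussians `X ~ N(μ₁, σ₁²)`, `Y ~ N(μ₂, σ₂²)` and `t` with
`t²σ₁²σ₂² < 1`,
`E[e^{-tXY}] = exp((-2tμ₁μ₂ + (μ₁²σ₂² + μ₂²σ₁²)t²)/(2(1 - t²σ₁²σ₂²))) / √(1 - t²σ₁²σ₂²)`,
the expectation written out as a double integral against the Gaussian densities. -/
theorem gaussian_exp_neg_mul_integral
    (μ₁ μ₂ σ₁ σ₂ : ℝ) (hσ₁ : 0 < σ₁) (hσ₂ : 0 < σ₂)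
    (t : ℝ) (ht : t ^ 2 * σ₁ ^ 2 * σ₂ ^ 2 < 1) :
    (1 / (2 * Real.pi * σ₁ * σ₂)) *
        ∫ x : ℝ, ∫ y : ℝ,
          Real.exp (-(t * x * y)) * Real.exp (-((x - μ₁) ^ 2 / (2 * σ₁ ^ 2))) *
            Real.exp (-((y - μ₂) ^ 2 / (2 * σ₂ ^ 2)))
      = Real.exp ((-(2 * t * μ₁ * μ₂) + (μ₁ ^ 2 * σ₂ ^ 2 + μ₂ ^ 2 * σ₁ ^ 2) * t ^ 2)
            / (2 * (1 - t ^ 2 * σ₁ ^ 2 * σ₂ ^ 2)))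
          / Real.sqrt (1 - t ^ 2 * σ₁ ^ 2 * σ₂ ^ 2) := by
  have hs : 0 < 1 - t ^ 2 * σ₁ ^ 2 * σ₂ ^ 2 := by linarith
  have inner_integral : ∀ x : ℝ,
      (∫ y : ℝ, Real.exp (-(t * x * y)) * Real.exp (-((x - μ₁) ^ 2 / (2 * σ₁ ^ 2))) *
            Real.exp (-((y - μ₂) ^ 2 / (2 * σ₂ ^ 2)))) =
        Real.exp (-((1 - t ^ 2 * σ₁ ^ 2 * σ₂ ^ 2) / (2 * σ₁ ^ 2)) * x ^ 2 +
          (μ₁ / σ₁ ^ 2 - t * μ₂) * x + -(μ₁ ^ 2 / (2 * σ₁ ^ 2))) *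
            Real.sqrt (Real.pi / (1 / (2 * σ₂ ^ 2))) := by
    intro x
    have h : ∀ y : ℝ, Real.exp (-(t * x * y)) * Real.exp (-((x - μ₁) ^ 2 / (2 * σ₁ ^ 2))) *
        Real.exp (-((y - μ₂) ^ 2 / (2 * σ₂ ^ 2))) =
        Real.exp (-(1 / (2 * σ₂ ^ 2)) * y ^ 2 + (μ₂ / σ₂ ^ 2 - t * x) * y +
          (-((x - μ₁) ^ 2 / (2 * σ₁ ^ 2)) - μ₂ ^ 2 / (2 * σ₂ ^ 2))) := by
      intro y
      rw [← Real.exp_add, ← Real.exp_add]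
      congr 1
      field_simp
      ring
    simp_rw [h]
    rw [integral_exp_quadratic (by positivity)]
    congr 2
    field_simp
    ring
  have hsqrt : Real.sqrt (Real.pi / ((1 - t ^ 2 * σ₁ ^ 2 * σ₂ ^ 2) / (2 * σ₁ ^ 2))) *
      Real.sqrt (Real.pi / (1 / (2 * σ₂ ^ 2))) =
      2 * Real.pi * σ₁ * σ₂ / Real.sqrt (1 - t ^ 2 * σ₁ ^ 2 * σ₂ ^ 2) := by
    rw [← Real.sqrt_mul (by positivity), ← Real.sqrt_sq (by positivity : 0 ≤ 2 * Real.pi * σ₁ * σ₂),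
      ← Real.sqrt_div (by positivity)]
    congr 1
    field_simp
  have hexp : -(μ₁ ^ 2 / (2 * σ₁ ^ 2)) + (μ₁ / σ₁ ^ 2 - t * μ₂) ^ 2 /
      (4 * ((1 - t ^ 2 * σ₁ ^ 2 * σ₂ ^ 2) / (2 * σ₁ ^ 2))) =
      (-(2 * t * μ₁ * μ₂) + (μ₁ ^ 2 * σ₂ ^ 2 + μ₂ ^ 2 * σ₁ ^ 2) * t ^ 2)
            / (2 * (1 - t ^ 2 * σ₁ ^ 2 * σ₂ ^ 2)) := by
    obtain ⟨D, hD⟩ : ∃ D, D = 1 - t ^ 2 * σ₁ ^ 2 * σ₂ ^ 2 := ⟨_, rfl⟩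
    rw [← hD] at hs ⊢
    field_simp
    rw [hD]
    ring
  simp_rw [inner_integral]
  rw [integral_mul_const, integral_exp_quadratic (by positivity), mul_assoc (Real.exp _), hsqrt, hexp]
  field_simp
end
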